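/- If a 3-CNF formula φ has a truth assignment under which every clause of φ contains exactly one true literal, then the graph G(φ) admits a planar geometric storyplan. -/

import Mathlib

/-- The straight-line drawing `D` of the subgraph of `G` induced by the visible
vertex set `S` is planar. -/
def IsPlanarSLFrame {V : Type*} (G : SimpleGraph V) (S : Set V) (D : V → ℝ × ℝ) : Prop :=
  Set.InjOn D S ∧
  (∀ u v w, G.Adj u v → u ∈ S → v ∈ S → w ∈ S → w ≠ u → w ≠ v →
      D w ∉ openSegment ℝ (D u) (D v)) ∧
  (∀ u v x y, G.Adj u v → G.Adj x y → u ∈ S → v ∈ S → x ∈ S → y ∈ S →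
      ¬((u = x ∧ v = y) ∨ (u = y ∧ v = x)) →
      ∀ p ∈ segment ℝ (D u) (D v) ∩ segment ℝ (D x) (D y),
        ∃ z, (z = u ∨ z = v) ∧ (z = x ∨ z = y) ∧ p = D z)

/-- `(len, s, e, D)` is a planar geometric storyplan of `G`: `len ≥ 1` time steps,
each vertex `v` is visible on the nonempty interval `[s v, e v] ⊆ [1, len]`,
the endpoints of every edge co-occur, and every frame is a planar
straight-line drawing. -/
def IsGeomStoryplan {V : Type*} (G : SimpleGraph V)
    (len : ℕ) (s e : V → ℕ) (D : V → ℝ × ℝ) : Prop :=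
  1 ≤ len ∧
  (∀ v, 1 ≤ s v ∧ s v ≤ e v ∧ e v ≤ len) ∧
  (∀ u v, G.Adj u v → ∃ t, s u ≤ t ∧ t ≤ e u ∧ s v ≤ t ∧ t ≤ e v) ∧
  (∀ t, 1 ≤ t → t ≤ len → IsPlanarSLFrame G {v | s v ≤ t ∧ t ≤ e v} D)

/-- `G` admits a planar geometric storyplan. -/
def HasGeomStoryplan {V : Type*} (G : SimpleGraph V) : Prop :=
  ∃ len s e D, IsGeomStoryplan G len s e D

/-- Vertices of the graph `G(φ)` for a 3-CNF formula `φ` with `n` variables and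
`m` clauses:
* `varv i b p` — the `p`-th vertex of the v-side of variable `xᵢ`
  (side `b = true` is `Aᵢ`, to which positive occurrences attach;
  side `b = false` is `Bᵢ`);
* `Uv j k u` — the `u`-th vertex of part `U_k` of the `K₂,₂,₂` of clause `Cⱼ`;
* `Sv j k` — the special vertex `s_k` of clause `Cⱼ`;
* `Wv j k w` — the `w`-th vertex of the w-side for the `k`-th literal of `Cⱼ`. -/
inductive PhiVert (n m : ℕ) : Type
  | varv : Fin n → Bool → Fin 3 → PhiVert n m
  | Uv : Fin m → Fin 3 → Fin 2 → PhiVert n m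
  | Sv : Fin m → Fin 3 → PhiVert n m
  | Wv : Fin m → Fin 3 → Fin 3 → PhiVert n m

/-- Base relation generating the edges of `G(φ)`, where `φ j k = (i, b)` means
that the `k`-th literal of clause `Cⱼ` is the variable `xᵢ`, positive if
`b = true` and negative if `b = false`:
* variable gadget: a `K₃,₃` between the two v-sides of each variable;
* clause gadget: a complete tripartite `K₂,₂,₂` on `U₁, U₂, U₃`, the three
  special vertices pairwise adjacent, and `s_k` adjacent to both vertices
  of `U_k`;
* wire gadget: each w-side vertex of the `k`-th literal of `Cⱼ` is adjacent to
  all three vertices of the `k`-th c-side `U_k ∪ {s_k}` of `K(Cⱼ)` and to all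
  three vertices of the v-side `Aᵢ` (if positive) resp. `Bᵢ` (if negative)
  of its variable. -/
def PhiRel {n m : ℕ} (φ : Fin m → Fin 3 → Fin n × Bool) :
    PhiVert n m → PhiVert n m → Prop
  | .varv i b _, .varv i' b' _ => i = i' ∧ b ≠ b'
  | .Uv j k _, .Uv j' k' _ => j = j' ∧ k ≠ k'
  | .Sv j k, .Sv j' k' => j = j' ∧ k ≠ k'
  | .Sv j k, .Uv j' k' _ => j = j' ∧ k = k'
  | .Wv j k _, .Uv j' k' _ => j = j' ∧ k = k'
  | .Wv j k _, .Sv j' k' => j = j' ∧ k = k'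
  | .Wv j k _, .varv i b _ => i = (φ j k).1 ∧ b = (φ j k).2
  | _, _ => False

/-- The graph `G(φ)` associated with the 3-CNF formula `φ`. -/
def PhiGraph {n m : ℕ} (φ : Fin m → Fin 3 → Fin n × Bool) :
    SimpleGraph (PhiVert n m) :=
  SimpleGraph.fromRel (PhiRel φ)


/-- Orientation determinant of three integer points. -/
def orient (P Q R : ℤ × ℤ) : ℤ :=
  (Q.1 - P.1) * (R.2 - P.2) - (Q.2 - P.2) * (R.1 - P.1)

/-- Certificate that the segments `PQ` and `RT` meet only in shared endpoints. -/
def Good (P Q R T : ℤ × ℤ) : Prop :=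
  (0 < orient P Q R ∧ 0 < orient P Q T) ∨ (orient P Q R < 0 ∧ orient P Q T < 0) ∨
  (0 < orient R T P ∧ 0 < orient R T Q) ∨ (orient R T P < 0 ∧ orient R T Q < 0) ∨
  ((P = R ∨ Q = R) ∧ orient P Q T ≠ 0) ∨ ((P = T ∨ Q = T) ∧ orient P Q R ≠ 0) ∨
  (P = R ∧ Q.1 < P.1 ∧ P.1 < T.1) ∨ (P = R ∧ T.1 < P.1 ∧ P.1 < Q.1)

/-- Certificate that the point `R` is not in the open segment `PQ`. -/
def VGood (P Q R : ℤ × ℤ) : Prop :=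
  orient P Q R ≠ 0 ∨ (P.1 < R.1 ∧ Q.1 < R.1) ∨ (R.1 < P.1 ∧ R.1 < Q.1)
    ∨ (P.2 < R.2 ∧ Q.2 < R.2) ∨ (R.2 < P.2 ∧ R.2 < Q.2)

instance (P Q R T : ℤ × ℤ) : Decidable (Good P Q R T) := by unfold Good; infer_instance
instance (P Q R : ℤ × ℤ) : Decidable (VGood P Q R) := by unfold VGood; infer_instance

/-- Embedding of the integer grid in the plane. -/
def toR (P : ℤ × ℤ) : ℝ × ℝ := ((P.1 : ℝ), (P.2 : ℝ))

theorem toR_inj {P Q : ℤ × ℤ} (h : toR P = toR Q) : P = Q := by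
  unfold toR at h
  rw [Prod.mk.injEq] at h
  exact Prod.ext (by exact_mod_cast h.1) (by exact_mod_cast h.2)

theorem mem_seg {P Q : ℤ × ℤ} {p : ℝ × ℝ} (h : p ∈ segment ℝ (toR P) (toR Q)) :
    ∃ b : ℝ, 0 ≤ b ∧ b ≤ 1 ∧ p.1 = P.1 + b * (Q.1 - P.1) ∧ p.2 = P.2 + b * (Q.2 - P.2) := by
  obtain ⟨a, b, ha, hb, hab, rfl⟩ := h
  refine ⟨b, hb, by linarith, ?_, ?_⟩ <;> simp [toR] <;>
    (obtain rfl : a = 1 - b := by linarith) <;> ring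

/-- Real orientation functional of the line `PQ`. -/
def orR (P Q : ℤ × ℤ) (p : ℝ × ℝ) : ℝ :=
  ((Q.1 : ℝ) - P.1) * (p.2 - P.2) - ((Q.2 : ℝ) - P.2) * (p.1 - P.1)

theorem orR_zero {P Q : ℤ × ℤ} {p : ℝ × ℝ} (h : p ∈ segment ℝ (toR P) (toR Q)) :
    orR P Q p = 0 := by
  obtain ⟨b, _, _, h1, h2⟩ := mem_seg h
  unfold orR; rw [h1, h2]; ring

theorem orR_conv {P Q R T : ℤ × ℤ} {p : ℝ × ℝ} (h : p ∈ segment ℝ (toR R) (toR T)) :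
    ∃ b : ℝ, 0 ≤ b ∧ b ≤ 1 ∧
      orR P Q p = (1 - b) * (orient P Q R : ℝ) + b * (orient P Q T : ℝ) ∧
      (b = 0 → p = toR R) ∧ (b = 1 → p = toR T) := by
  obtain ⟨b, h0, h1, e1, e2⟩ := mem_seg h
  refine ⟨b, h0, h1, ?_, ?_, ?_⟩
  · unfold orR orient; rw [e1, e2]; push_cast; ring
  · rintro rfl; exact Prod.ext (by simp [toR, e1]) (by simp [toR, e2])
  · rintro rfl; exact Prod.ext (by simp [toR, e1]) (by simp [toR, e2])

theorem no_pos {P Q R T : ℤ × ℤ} {p : ℝ × ℝ} (h : p ∈ segment ℝ (toR P) (toR Q))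
    (h' : p ∈ segment ℝ (toR R) (toR T)) (hR : 0 < orient P Q R) (hT : 0 < orient P Q T) :
    False := by
  obtain ⟨b, h0, h1, e, _⟩ := orR_conv (P := P) (Q := Q) h'
  rw [orR_zero h] at e
  have a1 : (0 : ℝ) < orient P Q R := by exact_mod_cast hR
  have a2 : (0 : ℝ) < orient P Q T := by exact_mod_cast hT
  rcases h0.eq_or_lt with rfl | h0
  · simp at e; linarith
  · have := mul_pos h0 a2
    have := mul_nonneg (sub_nonneg.2 h1) a1.le
    linarith

theorem no_neg {P Q R T : ℤ × ℤ} {p : ℝ × ℝ} (h : p ∈ segment ℝ (toR P) (toR Q))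
    (h' : p ∈ segment ℝ (toR R) (toR T)) (hR : orient P Q R < 0) (hT : orient P Q T < 0) :
    False := by
  refine no_pos (P := Q) (Q := P) (R := R) (T := T) (by rwa [segment_symm]) h' ?_ ?_
  · unfold orient at *; linarith
  · unfold orient at *; linarith

theorem share {P Q R T : ℤ × ℤ} {p : ℝ × ℝ} (h : p ∈ segment ℝ (toR P) (toR Q))
    (h' : p ∈ segment ℝ (toR R) (toR T)) (hR : orient P Q R = 0) (hT : orient P Q T ≠ 0) :
    p = toR R := by
  obtain ⟨b, h0, h1, e, e0, _⟩ := orR_conv (P := P) (Q := Q) h'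
  rw [orR_zero h, hR] at e
  have a2 : (orient P Q T : ℝ) ≠ 0 := by exact_mod_cast hT
  apply e0
  simpa [a2] using e

theorem opp {P Q T : ℤ × ℤ} {p : ℝ × ℝ} (h : p ∈ segment ℝ (toR P) (toR Q))
    (h' : p ∈ segment ℝ (toR P) (toR T)) (hQ : Q.1 < P.1) (hT : P.1 < T.1) :
    p = toR P := by
  obtain ⟨b, b0, b1, e1, e2⟩ := mem_seg h
  obtain ⟨c, c0, c1, f1, f2⟩ := mem_seg h'
  have hQ : (Q.1 : ℝ) < P.1 := by exact_mod_cast hQ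
  have hT : (P.1 : ℝ) < T.1 := by exact_mod_cast hT
  have hb : b = 0 := by
    by_contra hb
    have hb : 0 < b := lt_of_le_of_ne b0 (Ne.symm hb)
    have := mul_pos hb (sub_pos.2 hQ)
    have := mul_nonneg c0 (sub_pos.2 hT).le
    nlinarith
  subst hb
  exact Prod.ext (by simp [toR, e1]) (by simp [toR, e2])

theorem good_spec {P Q R T : ℤ × ℤ} (hg : Good P Q R T) {p : ℝ × ℝ}
    (h : p ∈ segment ℝ (toR P) (toR Q)) (h' : p ∈ segment ℝ (toR R) (toR T)) :
    (p = toR P ∨ p = toR Q) ∧ (p = toR R ∨ p = toR T) := by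
  have key : ∀ R T : ℤ × ℤ, p ∈ segment ℝ (toR R) (toR T) → (P = R ∨ Q = R) →
      orient P Q T ≠ 0 → (p = toR P ∨ p = toR Q) ∧ (p = toR R ∨ p = toR T) := by
    intro R T h' hs hT
    have : p = toR R := by
      refine share h h' ?_ hT
      rcases hs with rfl | rfl <;> unfold orient <;> ring
    refine ⟨?_, Or.inl this⟩
    rcases hs with rfl | rfl
    · exact Or.inl this
    · exact Or.inr this
  rcases hg with ⟨a, b⟩ | ⟨a, b⟩ | ⟨a, b⟩ | ⟨a, b⟩ | ⟨a, b⟩ | ⟨a, b⟩ | ⟨rfl, a, b⟩ | ⟨rfl, a, b⟩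
  · exact (no_pos h h' a b).elim
  · exact (no_neg h h' a b).elim
  · exact (no_pos h' h a b).elim
  · exact (no_neg h' h a b).elim
  · exact key R T h' a b
  · exact (key T R (by rwa [segment_symm]) a b).imp id Or.symm
  · have := opp h h' a b
    exact ⟨Or.inl this, Or.inl this⟩
  · have := opp h' h a b
    exact ⟨Or.inl this, Or.inl this⟩

theorem conv_lt {p q r b : ℝ} (h0 : 0 ≤ b) (h1 : b ≤ 1) (e : r = p + b * (q - p))
    (hp : p < r) (hq : q < r) : False := by
  rcases h0.eq_or_lt with rfl | h0
  · simp at e; linarith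
  · have := mul_pos h0 (sub_pos.2 hq)
    have := mul_nonneg (sub_nonneg.2 h1) (sub_pos.2 hp).le
    nlinarith

theorem conv_gt {p q r b : ℝ} (h0 : 0 ≤ b) (h1 : b ≤ 1) (e : r = p + b * (q - p))
    (hp : r < p) (hq : r < q) : False :=
  conv_lt (p := -p) (q := -q) (r := -r) h0 h1 (by rw [e]; ring) (by linarith) (by linarith)

theorem vgood_spec {P Q R : ℤ × ℤ} (hg : VGood P Q R) :
    toR R ∉ openSegment ℝ (toR P) (toR Q) := by
  intro h
  have h := openSegment_subset_segment ℝ _ _ h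
  rcases hg with a | a
  · have e := orR_zero h
    apply a
    simp only [orR, toR] at e; unfold orient
    exact_mod_cast e
  · obtain ⟨b, h0, h1, e1, e2⟩ := mem_seg h
    simp only [toR] at e1 e2
    rcases a with ⟨a1, a2⟩ | ⟨a1, a2⟩ | ⟨a1, a2⟩ | ⟨a1, a2⟩
    · exact conv_lt h0 h1 e1 (by exact_mod_cast a1) (by exact_mod_cast a2)
    · exact conv_gt h0 h1 e1 (by exact_mod_cast a1) (by exact_mod_cast a2)
    · exact conv_lt h0 h1 e2 (by exact_mod_cast a1) (by exact_mod_cast a2)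
    · exact conv_gt h0 h1 e2 (by exact_mod_cast a1) (by exact_mod_cast a2)

/-- Transfer lemma: planarity of a frame from an abstract certified drawing. -/
theorem frame_of {V : Type*} (G : SimpleGraph V) (S : Set V) (lab : V → ℤ × ℤ)
    (Ed : ℤ × ℤ → ℤ × ℤ → Prop) (Vis : ℤ × ℤ → Prop)
    (hinj : ∀ u ∈ S, ∀ v ∈ S, lab u = lab v → u = v)
    (hvis : ∀ v ∈ S, Vis (lab v))
    (hed : ∀ u ∈ S, ∀ v ∈ S, G.Adj u v → Ed (lab u) (lab v) ∨ Ed (lab v) (lab u))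
    (hgood : ∀ P Q R T, Ed P Q → Ed R T → (P = R ∧ Q = T) ∨ Good P Q R T)
    (hvgood : ∀ P Q R, Ed P Q → Vis R → R = P ∨ R = Q ∨ VGood P Q R) :
    IsPlanarSLFrame G S (fun v => toR (lab v)) := by
  refine ⟨?_, ?_, ?_⟩
  · intro u hu v hv h
    exact hinj u hu v hv (toR_inj h)
  · intro u v w huv hu hv hw hwu hwv
    have n1 : lab w ≠ lab u := fun h => hwu (hinj w hw u hu h)
    have n2 : lab w ≠ lab v := fun h => hwv (hinj w hw v hv h)
    rcases hed u hu v hv huv with h | h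
    · rcases hvgood _ _ _ h (hvis w hw) with h | h | h
      · exact (n1 h).elim
      · exact (n2 h).elim
      · exact vgood_spec h
    · rcases hvgood _ _ _ h (hvis w hw) with h | h | h
      · exact (n2 h).elim
      · exact (n1 h).elim
      · rw [openSegment_symm]; exact vgood_spec h
  · intro u v x y huv hxy hu hv hx hy hne p hp
    obtain ⟨hp1, hp2⟩ := hp
    have main : (p = toR (lab u) ∨ p = toR (lab v)) ∧ (p = toR (lab x) ∨ p = toR (lab y)) := by
      rcases hed u hu v hv huv with h | h <;> rcases hed x hx y hy hxy with h' | h'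
      · rcases hgood _ _ _ _ h h' with ⟨e1, e2⟩ | g
        · exact (hne (Or.inl ⟨hinj _ hu _ hx e1, hinj _ hv _ hy e2⟩)).elim
        · exact good_spec g hp1 hp2
      · rcases hgood _ _ _ _ h h' with ⟨e1, e2⟩ | g
        · exact (hne (Or.inr ⟨hinj _ hu _ hy e1, hinj _ hv _ hx e2⟩)).elim
        · exact (good_spec g hp1 (by rwa [segment_symm])).imp id Or.symm
      · rcases hgood _ _ _ _ h h' with ⟨e1, e2⟩ | g
        · exact (hne (Or.inr ⟨hinj _ hu _ hy e2, hinj _ hv _ hx e1⟩)).elim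
        · exact (good_spec g (by rwa [segment_symm]) hp2).imp Or.symm id
      · rcases hgood _ _ _ _ h h' with ⟨e1, e2⟩ | g
        · exact (hne (Or.inl ⟨hinj _ hu _ hx e2, hinj _ hv _ hy e1⟩)).elim
        · exact (good_spec g (by rwa [segment_symm]) (by rwa [segment_symm])).imp Or.symm Or.symm
    have eqv : ∀ {a b}, a ∈ S → b ∈ S → p = toR (lab a) → p = toR (lab b) → a = b :=
      fun ha hb h1 h2 => hinj _ ha _ hb (toR_inj (h1.symm.trans h2))
    obtain ⟨h1 | h1, h2 | h2⟩ := main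
    · exact ⟨u, Or.inl rfl, Or.inl (eqv hu hx h1 h2), h1⟩
    · exact ⟨u, Or.inl rfl, Or.inr (eqv hu hy h1 h2), h1⟩
    · exact ⟨v, Or.inr rfl, Or.inl (eqv hv hx h1 h2), h1⟩
    · exact ⟨v, Or.inr rfl, Or.inr (eqv hv hy h1 h2), h1⟩

/-! ### Abstract frames -/

/-- Fixed gadget edges of a frame in phase `f`. -/
def gadE : Fin 5 → List ((ℤ × ℤ) × (ℤ × ℤ))
  | 0 => []
  | 1 => [((0, 5), (-6, 1)), ((0, 5), (-2, -2)), ((0, -10), (-6, 1)), ((0, -10), (-2, -2)),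
          ((0, -10), (0, 5))]
  | 2 => [((0, 5), (-6, 1)), ((0, 5), (-2, -2)), ((0, 5), (0, 10)), ((0, 5), (20, 10)),
          ((0, 10), (20, 10))]
  | 3 => [((-6, 1), (-10, 0)), ((-6, 1), (-2, 0)), ((-2, -2), (-10, 0)), ((-2, -2), (-2, 0)),
          ((0, 10), (-10, 0)), ((0, 10), (-2, 0)), ((0, -10), (-10, 0)), ((0, -10), (-2, 0)),
          ((0, -10), (0, 10)), ((0, 10), (20, 10))]
  | 4 => [((-6, 1), (-10, 0)), ((-6, 1), (-2, 0)), ((-2, -2), (-10, 0)), ((-2, -2), (-2, 0)),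
          ((0, 10), (-10, 0)), ((0, 10), (-2, 0)), ((0, 10), (-6, 1)), ((0, 10), (-2, -2)),
          ((0, 10), (20, 10))]

/-- Centres of the stars to persistent points (`true`: upper points, `false`: lower points). -/
def starC : Fin 5 → List ((ℤ × ℤ) × Bool)
  | 0 => [((0, 0), true), ((0, 0), false)]
  | 1 => [((0, -10), false)]
  | 2 => [((20, 10), true)]
  | 3 => [((20, 10), true), ((0, -10), false)]
  | 4 => [((20, 10), true), ((0, 10), true)]

/-- Fixed gadget points visible in phase `f`. -/
def gadV : Fin 5 → List (ℤ × ℤ)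
  | 0 => [(0, 0)]
  | 1 => [(0, 5), (-6, 1), (-2, -2), (0, -10)]
  | 2 => [(0, 5), (-6, 1), (-2, -2), (0, 10), (20, 10)]
  | 3 => [(-6, 1), (-2, -2), (-10, 0), (-2, 0), (0, 10), (20, 10), (0, -10)]
  | 4 => [(-6, 1), (-2, -2), (-10, 0), (-2, 0), (0, 10), (20, 10)]

/-- Persistent point of height `y`, in the upper or lower group. -/
def PerY (c : Bool) (y : ℤ) : Prop := (c = true ∧ 11 ≤ y) ∨ (c = false ∧ y ≤ -1)

def EdF (f : Fin 5) (P Q : ℤ × ℤ) : Prop :=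
  (P, Q) ∈ gadE f ∨ ∃ c y, (P, c) ∈ starC f ∧ PerY c y ∧ Q = (10, y)

def VisF (f : Fin 5) (P : ℤ × ℤ) : Prop :=
  P ∈ gadV f ∨ ∃ c y, PerY c y ∧ P = (10, y)

theorem gad_gad : ∀ f, ∀ e ∈ gadE f, ∀ e' ∈ gadE f, e = e' ∨ Good e.1 e.2 e'.1 e'.2 := by
  decide +kernel

theorem gad_v : ∀ f, ∀ e ∈ gadE f, ∀ R ∈ gadV f, R = e.1 ∨ R = e.2 ∨ VGood e.1 e.2 R := by
  decide +kernel

theorem gad_star : ∀ f, ∀ e ∈ gadE f, ∀ c ∈ starC f,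
    ∀ y : ℤ, PerY c.2 y → Good e.1 e.2 c.1 (10, y) := by
  intro f
  fin_cases f <;> simp [gadE, starC, Good, orient, PerY] <;> (and_intros <;> intros <;> omega)

theorem star_starF : ∀ f, ∀ c ∈ starC f, ∀ c' ∈ starC f,
    ∀ y y' : ℤ, PerY c.2 y → PerY c'.2 y' →
      (c.1 = c'.1 ∧ y = y') ∨ Good c.1 (10, y) c'.1 (10, y') := by
  intro f
  fin_cases f <;> simp [starC, Good, orient, PerY] <;> (and_intros <;> intros <;> omega)

theorem gad_per : ∀ f, ∀ e ∈ gadE f, ∀ (c : Bool) (y : ℤ), PerY c y → VGood e.1 e.2 (10, y) := by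
  intro f
  fin_cases f <;> simp [gadE, VGood, orient, PerY] <;> (and_intros <;> intros <;> omega)

theorem star_v : ∀ f, ∀ c ∈ starC f, ∀ R ∈ gadV f,
    ∀ y : ℤ, PerY c.2 y → R = c.1 ∨ R = (10, y) ∨ VGood c.1 (10, y) R := by
  intro f
  fin_cases f <;> simp [starC, gadV, VGood, orient, PerY] <;> (and_intros <;> intros <;> omega)

theorem star_per : ∀ f, ∀ c ∈ starC f, ∀ y y' : ℤ, y = y' ∨ VGood c.1 (10, y) (10, y') := by
  intro f
  fin_cases f <;> simp [starC, VGood, orient] <;> (and_intros <;> intros <;> omega)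

theorem Good.symm {P Q R T : ℤ × ℤ} (h : Good P Q R T) : Good R T P Q := by
  unfold Good at *
  rcases h with h | h | h | h | ⟨rfl | rfl, h⟩ | ⟨rfl | rfl, h⟩ | ⟨rfl, h⟩ | ⟨rfl, h⟩
  · exact Or.inr (Or.inr (Or.inl h))
  · exact Or.inr (Or.inr (Or.inr (Or.inl h)))
  · exact Or.inl h
  · exact Or.inr (Or.inl h)
  · have e : orient P T Q = - orient P Q T := by unfold orient; ring
    have : orient P T Q ≠ 0 := by omega
    exact Or.inr (Or.inr (Or.inr (Or.inr (Or.inl ⟨Or.inl rfl, this⟩))))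
  · have e : orient Q T P = orient P Q T := by unfold orient; ring
    have : orient Q T P ≠ 0 := by omega
    exact Or.inr (Or.inr (Or.inr (Or.inr (Or.inr (Or.inl ⟨Or.inl rfl, this⟩)))))
  · have e : orient R P Q = orient P Q R := by unfold orient; ring
    have : orient R P Q ≠ 0 := by omega
    exact Or.inr (Or.inr (Or.inr (Or.inr (Or.inl ⟨Or.inr rfl, this⟩))))
  · have e : orient R Q P = - orient P Q R := by unfold orient; ring
    have : orient R Q P ≠ 0 := by omega
    exact Or.inr (Or.inr (Or.inr (Or.inr (Or.inr (Or.inl ⟨Or.inr rfl, this⟩)))))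
  · exact Or.inr (Or.inr (Or.inr (Or.inr (Or.inr (Or.inr (Or.inr ⟨rfl, h⟩))))))
  · exact Or.inr (Or.inr (Or.inr (Or.inr (Or.inr (Or.inr (Or.inl ⟨rfl, h⟩))))))

theorem edF_good (f : Fin 5) (P Q R T : ℤ × ℤ) (h : EdF f P Q) (h' : EdF f R T) :
    (P = R ∧ Q = T) ∨ Good P Q R T := by
  rcases h with h | ⟨c, y, hc, hy, rfl⟩ <;> rcases h' with h' | ⟨c', y', hc', hy', rfl⟩
  · simpa using gad_gad f _ h _ h'
  · exact Or.inr (gad_star f _ h _ hc' y' hy')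
  · exact Or.inr (gad_star f _ h' _ hc y hy).symm
  · simpa using star_starF f _ hc _ hc' y y' hy hy'

theorem edF_vgood (f : Fin 5) (P Q R : ℤ × ℤ) (h : EdF f P Q) (h' : VisF f R) :
    R = P ∨ R = Q ∨ VGood P Q R := by
  rcases h with h | ⟨c, y, hc, hy, rfl⟩ <;> rcases h' with h' | ⟨c', y', hy', rfl⟩
  · exact gad_v f _ h _ h'
  · exact Or.inr (Or.inr (gad_per f _ h _ _ hy'))
  · exact star_v f _ hc _ h' y hy
  · rcases star_per f _ hc y y' with rfl | h
    · exact Or.inr (Or.inl rfl)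
    · exact Or.inr (Or.inr h)

/-! ### The storyplan -/

/-- Position, start and end (relative to the clause) of `U`-vertices of role `r`
(role `0`: true literal, roles `1`, `2`: false literals). -/
def labU : Fin 3 → Fin 2 → ℤ × ℤ
  | 0, _ => (0, 10)
  | 1, 0 => (-6, 1)
  | 1, 1 => (-2, -2)
  | 2, 0 => (-10, 0)
  | 2, 1 => (-2, 0)
def sU : Fin 3 → Fin 2 → ℕ
  | 0, u => 8 + u
  | 1, _ => 1
  | 2, _ => 5
def eU : Fin 3 → Fin 2 → ℕ
  | 0, u => 8 + u
  | 1, _ => 9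
  | 2, _ => 9
def labS : Fin 3 → ℤ × ℤ
  | 0 => (20, 10)
  | 1 => (0, 5)
  | 2 => (0, 10)
def sS : Fin 3 → ℕ
  | 0 => 4
  | 1 => 1
  | 2 => 4
def eS : Fin 3 → ℕ
  | 0 => 9
  | 1 => 4
  | 2 => 7
/-- Relative time step of the `w`-th wire vertex of role `r ≠ 0`. -/
def tW (r : Fin 3) (w : Fin 3) : ℕ := if r = 1 then 1 + w else 5 + w

variable {n m : ℕ}

/-- Position of the vertices (`t j` is the index of the true literal of clause `j`). -/
def lab (τ : Fin n → Bool) (t : Fin m → Fin 3) : PhiVert n m → ℤ × ℤ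
  | .varv i b p => if b = τ i then (0, 0) else (10, -(3 * (i : ℕ) + (p : ℕ) + 1 : ℤ))
  | .Uv j k u => labU (k - t j) u
  | .Sv j k => labS (k - t j)
  | .Wv j k w => if k = t j then (10, 11 + 3 * (j : ℕ) + (w : ℕ)) else (0, -10)

def sT (τ : Fin n → Bool) (t : Fin m → Fin 3) : PhiVert n m → ℕ
  | .varv i b p => if b = τ i then 3 * i + p + 1 else 1
  | .Uv j k u => 3 * n + 9 * j + sU (k - t j) u
  | .Sv j k => 3 * n + 9 * j + sS (k - t j)
  | .Wv j k w => if k = t j then 1 else 3 * n + 9 * j + tW (k - t j) w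

def eT (τ : Fin n → Bool) (t : Fin m → Fin 3) : PhiVert n m → ℕ
  | .varv i b p => if b = τ i then 3 * i + p + 1 else 3 * n + 9 * m + 1
  | .Uv j k u => 3 * n + 9 * j + eU (k - t j) u
  | .Sv j k => 3 * n + 9 * j + eS (k - t j)
  | .Wv j k w => if k = t j then 3 * n + 9 * m + 1 else 3 * n + 9 * j + tW (k - t j) w

theorem bU : ∀ r u, 1 ≤ sU r u ∧ sU r u ≤ eU r u ∧ eU r u ≤ 9 := by decide
theorem bS : ∀ r, 1 ≤ sS r ∧ sS r ≤ eS r ∧ eS r ≤ 9 := by decide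
theorem bW : ∀ r w, 1 ≤ tW r w ∧ tW r w ≤ 9 := by decide

theorem times_ok (τ : Fin n → Bool) (t : Fin m → Fin 3) (v : PhiVert n m) :
    1 ≤ sT τ t v ∧ sT τ t v ≤ eT τ t v ∧ eT τ t v ≤ 3 * n + 9 * m + 1 := by
  rcases v with ⟨i, b, p⟩ | ⟨j, k, u⟩ | ⟨j, k⟩ | ⟨j, k, w⟩ <;> simp only [sT, eT]
  · split_ifs <;> omega
  · have := bU (k - t j) u; omega
  · have := bS (k - t j); omega
  · have := bW (k - t j) w; split_ifs <;> omega

/-- Symmetric statements about adjacent vertices may be checked on the base relation. -/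
theorem adj_sym (φ : Fin m → Fin 3 → Fin n × Bool) (X : PhiVert n m → PhiVert n m → Prop)
    (hs : ∀ u v, X u v → X v u) (h : ∀ u v, PhiRel φ u v → X u v) (u v : PhiVert n m)
    (ha : (PhiGraph φ).Adj u v) : X u v := by
  rw [PhiGraph, SimpleGraph.fromRel_adj] at ha
  rcases ha.2 with h' | h'
  · exact h _ _ h'
  · exact hs _ _ (h _ _ h')

theorem oUU : ∀ r u r' u', r ≠ r' → ∃ d < 10, sU r u ≤ d ∧ d ≤ eU r u ∧ sU r' u' ≤ d ∧ d ≤ eU r' u' := by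
  decide
theorem oSU : ∀ r u, ∃ d < 10, sS r ≤ d ∧ d ≤ eS r ∧ sU r u ≤ d ∧ d ≤ eU r u := by decide
theorem oWU : ∀ r w u, r ≠ 0 → sU r u ≤ tW r w ∧ tW r w ≤ eU r u := by decide
theorem oWS : ∀ r w, r ≠ 0 → sS r ≤ tW r w ∧ tW r w ≤ eS r := by decide
theorem oSS : ∀ r, sS r ≤ 4 ∧ 4 ≤ eS r := by decide

theorem overlap (φ : Fin m → Fin 3 → Fin n × Bool) (τ : Fin n → Bool) (t : Fin m → Fin 3)
    (ht : ∀ j k, τ (φ j k).1 = (φ j k).2 ↔ k = t j) (u v : PhiVert n m)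
    (h : PhiRel φ u v) : ∃ x, sT τ t u ≤ x ∧ x ≤ eT τ t u ∧ sT τ t v ≤ x ∧ x ≤ eT τ t v := by
  have hu := times_ok τ t u
  have hv := times_ok τ t v
  rcases u with ⟨i, b, p⟩ | ⟨j, k, u⟩ | ⟨j, k⟩ | ⟨j, k, w⟩ <;>
    rcases v with ⟨i', b', p'⟩ | ⟨j', k', u'⟩ | ⟨j', k'⟩ | ⟨j', k', w'⟩ <;>
    simp only [PhiRel] at h <;> obtain ⟨rfl, h⟩ := h
  · by_cases hb : b = τ i
    · have hb' : b' ≠ τ i := fun h' => h (hb.trans h'.symm)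
      simp only [sT, eT, if_pos hb, if_neg hb'] at *
      exact ⟨3 * i + p + 1, by omega⟩
    · have hb' : b' = τ i := by
        revert h hb; cases b <;> cases b' <;> cases τ i <;> simp
      simp only [sT, eT, if_neg hb, if_pos hb'] at *
      exact ⟨3 * i + p' + 1, by omega⟩
  · obtain ⟨d, _, h⟩ := oUU (k - t j) u (k' - t j) u' (by simpa [sub_left_inj] using h)
    exact ⟨3 * n + 9 * j + d, by simp only [sT, eT]; omega⟩
  · subst h
    obtain ⟨d, _, h⟩ := oSU (k - t j) u'
    exact ⟨3 * n + 9 * j + d, by simp only [sT, eT]; omega⟩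
  · have h1 := oSS (k - t j)
    have h2 := oSS (k' - t j)
    exact ⟨3 * n + 9 * j + 4, by simp only [sT, eT]; omega⟩
  · subst h
    by_cases hk : (φ j k).2 = τ (φ j k).1
    · have hk' := (ht j k).1 hk.symm
      simp only [sT, eT, if_pos hk, if_pos hk'] at *
      exact ⟨_, hv.1, hv.2.2, le_rfl, le_rfl⟩
    · have hk' : k ≠ t j := fun h => hk ((ht j k).2 h).symm
      simp only [sT, eT, if_neg hk, if_neg hk'] at *
      exact ⟨_, le_rfl, le_rfl, hu.1, hu.2.2⟩
  · subst h
    by_cases hk : k = t j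
    · simp only [sT, eT, if_pos hk] at *
      exact ⟨_, hv.1, by omega, le_rfl, by omega⟩
    · have := oWU (k - t j) w u' (by simpa [sub_eq_zero] using hk)
      simp only [sT, eT, if_neg hk] at *
      exact ⟨_, le_rfl, le_rfl, by omega, by omega⟩
  · subst h
    by_cases hk : k = t j
    · simp only [sT, eT, if_pos hk] at *
      exact ⟨_, hv.1, by omega, le_rfl, by omega⟩
    · have := oWS (k - t j) w (by simpa [sub_eq_zero] using hk)
      simp only [sT, eT, if_neg hk] at *
      exact ⟨_, le_rfl, le_rfl, by omega, by omega⟩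

/-- Frame type of the relative time step `d` of a clause. -/
def ph (d : Fin 10) : Fin 5 := if d ≤ 3 then 1 else if d = 4 then 2 else if d ≤ 7 then 3 else 4

theorem c_visU : ∀ (d : Fin 10) r u, sU r u ≤ d → d ≤ eU r u → labU r u ∈ gadV (ph d) := by
  decide
theorem c_visS : ∀ (d : Fin 10) r, sS r ≤ d → d ≤ eS r → labS r ∈ gadV (ph d) := by
  decide
theorem c_visW : ∀ (d : Fin 10) r w, r ≠ 0 → tW r w = d → (0, -10) ∈ gadV (ph d) := by
  decide
theorem c_UU : ∀ (d : Fin 10) r u r' u', sU r u ≤ d → d ≤ eU r u → sU r' u' ≤ d → d ≤ eU r' u' →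
    labU r u = labU r' u' → r = r' ∧ u = u' := by
  decide +kernel
set_option synthInstance.maxSize 2000 in
set_option synthInstance.maxHeartbeats 400000 in
theorem c_US : ∀ (d : Fin 10) r u r', sU r u ≤ d → d ≤ eU r u → sS r' ≤ d → d ≤ eS r' →
    labU r u ≠ labS r' := by
  decide +kernel
theorem c_SS : ∀ (d : Fin 10) r r', sS r ≤ d → d ≤ eS r → sS r' ≤ d → d ≤ eS r' →
    labS r = labS r' → r = r' := by
  decide +kernel
theorem c_WW : ∀ r w r' w', r ≠ 0 → r' ≠ 0 → tW r w = tW r' w' → r = r' ∧ w = w' := by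
  decide +kernel
theorem c_U : ∀ r u, labU r u ≠ (0, -10) ∧ (labU r u).1 ≠ 10 := by decide
theorem c_S : ∀ r, labS r ≠ (0, -10) ∧ (labS r).1 ≠ 10 := by decide
set_option synthInstance.maxSize 2000 in
set_option synthInstance.maxHeartbeats 400000 in
theorem e_UU : ∀ (d : Fin 10) r u r' u', sU r u ≤ d → d ≤ eU r u → sU r' u' ≤ d → d ≤ eU r' u' →
    r ≠ r' → (labU r u, labU r' u') ∈ gadE (ph d) ∨ (labU r' u', labU r u) ∈ gadE (ph d) := by
  decide +kernel
set_option synthInstance.maxSize 2000 in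
set_option synthInstance.maxHeartbeats 400000 in
theorem e_SS : ∀ (d : Fin 10) r r', sS r ≤ d → d ≤ eS r → sS r' ≤ d → d ≤ eS r' →
    r ≠ r' → (labS r, labS r') ∈ gadE (ph d) ∨ (labS r', labS r) ∈ gadE (ph d) := by
  decide +kernel
theorem e_SU : ∀ (d : Fin 10) r u, sS r ≤ d → d ≤ eS r → sU r u ≤ d → d ≤ eU r u →
    (labS r, labU r u) ∈ gadE (ph d) ∨ (labU r u, labS r) ∈ gadE (ph d) := by
  decide +kernel
theorem e_WU : ∀ (d : Fin 10) r w u, r ≠ 0 → tW r w = d → sU r u ≤ d → d ≤ eU r u →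
    ((0, -10), labU r u) ∈ gadE (ph d) := by
  decide +kernel
theorem e_WS : ∀ (d : Fin 10) r w, r ≠ 0 → tW r w = d → sS r ≤ d → d ≤ eS r →
    ((0, -10), labS r) ∈ gadE (ph d) := by
  decide +kernel
theorem e_W0U : ∀ (d : Fin 10) u, sU 0 u ≤ d → d ≤ eU 0 u → (labU 0 u, true) ∈ starC (ph d) := by
  decide
theorem e_W0S : ∀ (d : Fin 10), sS 0 ≤ d → d ≤ eS 0 → (labS 0, true) ∈ starC (ph d) := by
  decide
theorem e_Wv : ∀ (d : Fin 10) r w, r ≠ 0 → tW r w = d → ((0, -10), false) ∈ starC (ph d) := by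
  decide

/-- The vertices visible at a time step. -/
def visAt (τ : Fin n → Bool) (t : Fin m → Fin 3) (x : ℕ) : Set (PhiVert n m) :=
  {v | sT τ t v ≤ x ∧ x ≤ eT τ t v}

theorem vis_clause (τ : Fin n → Bool) (t : Fin m → Fin 3) (j₀ : Fin m) (d : Fin 10)
    (hd : 1 ≤ (d : ℕ)) (v : PhiVert n m) (hv : v ∈ visAt τ t (3 * n + 9 * j₀ + d)) :
    (∃ i b p, v = .varv i b p ∧ b ≠ τ i ∧ lab τ t v = (10, -(3 * (i : ℕ) + (p : ℕ) + 1 : ℤ))) ∨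
    (∃ k u, v = .Uv j₀ k u ∧ sU (k - t j₀) u ≤ d ∧ d ≤ eU (k - t j₀) u ∧
      lab τ t v = labU (k - t j₀) u) ∨
    (∃ k, v = .Sv j₀ k ∧ sS (k - t j₀) ≤ d ∧ d ≤ eS (k - t j₀) ∧ lab τ t v = labS (k - t j₀)) ∨
    (∃ j w, v = .Wv j (t j) w ∧ lab τ t v = (10, (11 + 3 * (j : ℕ) + (w : ℕ) : ℤ))) ∨
    (∃ k w, v = .Wv j₀ k w ∧ k - t j₀ ≠ 0 ∧ tW (k - t j₀) w = d ∧ lab τ t v = (0, -10)) := by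
  obtain ⟨h1, h2⟩ := hv
  have hd9 := d.2
  rcases v with ⟨i, b, p⟩ | ⟨j, k, u⟩ | ⟨j, k⟩ | ⟨j, k, w⟩ <;> simp only [sT, eT] at h1 h2
  · left
    by_cases hb : b = τ i
    · rw [if_pos hb] at h2; omega
    · exact ⟨i, b, p, rfl, hb, by simp only [lab, if_neg hb]⟩
  · right; left
    have := bU (k - t j) u
    obtain rfl : j = j₀ := Fin.ext (by omega)
    exact ⟨k, u, rfl, by omega, by omega, rfl⟩
  · right; right; left
    have := bS (k - t j)
    obtain rfl : j = j₀ := Fin.ext (by omega)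
    exact ⟨k, rfl, by omega, by omega, rfl⟩
  · right; right; right
    have := bW (k - t j) w
    by_cases hk : k = t j
    · left
      subst hk
      exact ⟨j, w, rfl, by simp only [lab, if_pos]⟩
    · right
      rw [if_neg hk] at h1 h2
      obtain rfl : j = j₀ := Fin.ext (by omega)
      exact ⟨k, w, rfl, by simpa [sub_eq_zero] using hk, by omega, by simp only [lab, if_neg hk]⟩

theorem frame_clause (φ : Fin m → Fin 3 → Fin n × Bool) (τ : Fin n → Bool) (t : Fin m → Fin 3)
    (ht : ∀ j k, τ (φ j k).1 = (φ j k).2 ↔ k = t j) (j₀ : Fin m) (d : Fin 10)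
    (hd : 1 ≤ (d : ℕ)) :
    IsPlanarSLFrame (PhiGraph φ) (visAt τ t (3 * n + 9 * j₀ + d)) (fun v => toR (lab τ t v)) := by
  refine frame_of _ _ _ (EdF (ph d)) (VisF (ph d)) ?_ ?_ ?_ (edF_good _) (edF_vgood _)
  · intro u hu v hv h
    rcases vis_clause τ t j₀ d hd u hu with ⟨i, b, p, rfl, hb, e⟩ | ⟨k, a, rfl, h1, h2, e⟩ |
        ⟨k, rfl, h1, h2, e⟩ | ⟨j, w, rfl, e⟩ | ⟨k, w, rfl, h1, h2, e⟩ <;>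
      rcases vis_clause τ t j₀ d hd v hv with ⟨i', b', p', rfl, hb', e'⟩ |
        ⟨k', a', rfl, h1', h2', e'⟩ | ⟨k', rfl, h1', h2', e'⟩ | ⟨j', w', rfl, e'⟩ |
        ⟨k', w', rfl, h1', h2', e'⟩ <;> rw [e, e'] at h
    · simp only [Prod.mk.injEq, true_and] at h
      obtain rfl : i = i' := Fin.ext (by omega)
      obtain rfl : p = p' := Fin.ext (by omega)
      obtain rfl : b = b' := by revert hb hb'; cases b <;> cases b' <;> cases τ i <;> simp
      rfl
    · exact ((c_U _ _).2 (by rw [← h])).elim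
    · exact ((c_S _).2 (by rw [← h])).elim
    · simp only [Prod.mk.injEq, true_and] at h; omega
    · simp at h
    · exact ((c_U _ _).2 (by rw [h])).elim
    · obtain ⟨h3, rfl⟩ := c_UU d _ _ _ _ h1 h2 h1' h2' h
      rw [sub_left_inj] at h3; rw [h3]
    · exact (c_US d _ _ _ h1 h2 h1' h2' h).elim
    · exact ((c_U _ _).2 (by rw [h])).elim
    · exact ((c_U _ _).1 h).elim
    · exact ((c_S _).2 (by rw [h])).elim
    · exact (c_US d _ _ _ h1' h2' h1 h2 h.symm).elim
    · have h3 := c_SS d _ _ h1 h2 h1' h2' h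
      rw [sub_left_inj] at h3; rw [h3]
    · exact ((c_S _).2 (by rw [h])).elim
    · exact ((c_S _).1 h).elim
    · simp only [Prod.mk.injEq, true_and] at h; omega
    · exact ((c_U _ _).2 (by rw [← h])).elim
    · exact ((c_S _).2 (by rw [← h])).elim
    · simp only [Prod.mk.injEq, true_and] at h
      obtain rfl : j = j' := Fin.ext (by omega)
      obtain rfl : w = w' := Fin.ext (by omega)
      rfl
    · simp at h
    · simp at h
    · exact ((c_U _ _).1 h.symm).elim
    · exact ((c_S _).1 h.symm).elim
    · simp at h
    · obtain ⟨h3, rfl⟩ := c_WW _ _ _ _ h1 h1' (h2.trans h2'.symm)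
      rw [sub_left_inj] at h3; rw [h3]
  · intro u hu
    rcases vis_clause τ t j₀ d hd u hu with ⟨i, b, p, rfl, hb, e⟩ | ⟨k, a, rfl, h1, h2, e⟩ |
        ⟨k, rfl, h1, h2, e⟩ | ⟨j, w, rfl, e⟩ | ⟨k, w, rfl, h1, h2, e⟩ <;> rw [e]
    · exact Or.inr ⟨false, _, Or.inr ⟨rfl, by omega⟩, rfl⟩
    · exact Or.inl (c_visU d _ _ h1 h2)
    · exact Or.inl (c_visS d _ h1 h2)
    · exact Or.inr ⟨true, _, Or.inl ⟨rfl, by omega⟩, rfl⟩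
    · exact Or.inl (c_visW d _ _ h1 h2)
  · intro u hu v hv ha
    refine adj_sym φ (fun u v => u ∈ visAt τ t (3 * n + 9 * j₀ + d) →
      v ∈ visAt τ t (3 * n + 9 * j₀ + d) → EdF (ph d) (lab τ t u) (lab τ t v) ∨
        EdF (ph d) (lab τ t v) (lab τ t u)) (fun u v h h1 h2 => (h h2 h1).symm) ?_ u v ha hu hv
    clear ha hu hv u v
    intro u v h hu hv
    rcases vis_clause τ t j₀ d hd u hu with ⟨i, b, p, rfl, hb, e⟩ | ⟨k, a, rfl, h1, h2, e⟩ |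
        ⟨k, rfl, h1, h2, e⟩ | ⟨j, w, rfl, e⟩ | ⟨k, w, rfl, h1, h2, e⟩ <;>
      rcases vis_clause τ t j₀ d hd v hv with ⟨i', b', p', rfl, hb', e'⟩ |
        ⟨k', a', rfl, h1', h2', e'⟩ | ⟨k', rfl, h1', h2', e'⟩ | ⟨j', w', rfl, e'⟩ |
        ⟨k', w', rfl, h1', h2', e'⟩ <;> simp only [PhiRel] at h <;> rw [e, e']
    · obtain ⟨rfl, h⟩ := h
      exfalso
      revert h hb hb'; cases b <;> cases b' <;> cases τ i <;> simp
    · exact (e_UU d _ _ _ _ h1 h2 h1' h2' (by simpa [sub_left_inj] using h)).imp Or.inl Or.inl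
    · obtain rfl := h.2
      exact (e_SU d _ _ h1 h2 h1' h2').imp Or.inl Or.inl
    · exact (e_SS d _ _ h1 h2 h1' h2' (by simpa [sub_left_inj] using h)).imp Or.inl Or.inl
    · exfalso
      obtain ⟨rfl, rfl⟩ := h
      exact hb' ((ht _ _).2 rfl).symm
    · obtain ⟨rfl, rfl⟩ := h
      rw [sub_self] at *
      exact Or.inr (Or.inr ⟨true, _, e_W0U d _ h1' h2', Or.inl ⟨rfl, by omega⟩, rfl⟩)
    · obtain ⟨rfl, rfl⟩ := h
      rw [sub_self] at *
      exact Or.inr (Or.inr ⟨true, _, e_W0S d h1' h2', Or.inl ⟨rfl, by omega⟩, rfl⟩)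
    · exact Or.inl (Or.inr ⟨false, _, e_Wv d _ _ h1 h2, Or.inr ⟨rfl, by omega⟩, rfl⟩)
    · obtain rfl := h.2
      exact Or.inl (Or.inl (e_WU d _ _ _ h1 h2 h1' h2'))
    · obtain rfl := h.2
      exact Or.inl (Or.inl (e_WS d _ _ h1 h2 h1' h2'))

theorem vis_var (τ : Fin n → Bool) (t : Fin m → Fin 3) (x : ℕ)
    (hx : x ≤ 3 * n ∨ x = 3 * n + 9 * m + 1) (v : PhiVert n m) (hv : v ∈ visAt τ t x) :
    (∃ i b p, v = .varv i b p ∧ b ≠ τ i ∧ lab τ t v = (10, -(3 * (i : ℕ) + (p : ℕ) + 1 : ℤ))) ∨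
    (∃ i p, v = .varv i (τ i) p ∧ x = 3 * i + p + 1 ∧ lab τ t v = (0, 0)) ∨
    (∃ j w, v = .Wv j (t j) w ∧ lab τ t v = (10, (11 + 3 * (j : ℕ) + (w : ℕ) : ℤ))) := by
  obtain ⟨h1, h2⟩ := hv
  rcases v with ⟨i, b, p⟩ | ⟨j, k, u⟩ | ⟨j, k⟩ | ⟨j, k, w⟩ <;> simp only [sT, eT] at h1 h2
  · by_cases hb : b = τ i
    · subst hb
      rw [if_pos rfl] at h1 h2
      exact Or.inr (Or.inl ⟨i, p, rfl, by omega, by simp only [lab, if_pos]⟩)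
    · exact Or.inl ⟨i, b, p, rfl, hb, by simp only [lab, if_neg hb]⟩
  · have := bU (k - t j) u; omega
  · have := bS (k - t j); omega
  · right; right
    have := bW (k - t j) w
    by_cases hk : k = t j
    · subst hk
      exact ⟨j, w, rfl, by simp only [lab, if_pos]⟩
    · rw [if_neg hk] at h1 h2; omega

theorem frame_var (φ : Fin m → Fin 3 → Fin n × Bool) (τ : Fin n → Bool) (t : Fin m → Fin 3)
    (ht : ∀ j k, τ (φ j k).1 = (φ j k).2 ↔ k = t j) (x : ℕ)
    (hx : x ≤ 3 * n ∨ x = 3 * n + 9 * m + 1) :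
    IsPlanarSLFrame (PhiGraph φ) (visAt τ t x) (fun v => toR (lab τ t v)) := by
  refine frame_of _ _ _ (EdF 0) (VisF 0) ?_ ?_ ?_ (edF_good _) (edF_vgood _)
  · intro u hu v hv h
    rcases vis_var τ t x hx u hu with ⟨i, b, p, rfl, hb, e⟩ | ⟨i, p, rfl, h1, e⟩ |
        ⟨j, w, rfl, e⟩ <;>
      rcases vis_var τ t x hx v hv with ⟨i', b', p', rfl, hb', e'⟩ | ⟨i', p', rfl, h1', e'⟩ |
        ⟨j', w', rfl, e'⟩ <;> rw [e, e'] at h <;> simp only [Prod.mk.injEq, true_and] at h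
    · obtain rfl : i = i' := Fin.ext (by omega)
      obtain rfl : p = p' := Fin.ext (by omega)
      obtain rfl : b = b' := by revert hb hb'; cases b <;> cases b' <;> cases τ i <;> simp
      rfl
    · omega
    · omega
    · omega
    · obtain rfl : i = i' := Fin.ext (by omega)
      obtain rfl : p = p' := Fin.ext (by omega)
      rfl
    · omega
    · omega
    · omega
    · obtain rfl : j = j' := Fin.ext (by omega)
      obtain rfl : w = w' := Fin.ext (by omega)
      rfl
  · intro u hu
    rcases vis_var τ t x hx u hu with ⟨i, b, p, rfl, hb, e⟩ | ⟨i, p, rfl, h1, e⟩ |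
        ⟨j, w, rfl, e⟩ <;> rw [e]
    · exact Or.inr ⟨false, _, Or.inr ⟨rfl, by omega⟩, rfl⟩
    · exact Or.inl (by decide)
    · exact Or.inr ⟨true, _, Or.inl ⟨rfl, by omega⟩, rfl⟩
  · intro u hu v hv ha
    refine adj_sym φ (fun u v => u ∈ visAt τ t x →
      v ∈ visAt τ t x → EdF 0 (lab τ t u) (lab τ t v) ∨
        EdF 0 (lab τ t v) (lab τ t u)) (fun u v h h1 h2 => (h h2 h1).symm) ?_ u v ha hu hv
    clear ha hu hv u v
    intro u v h hu hv
    rcases vis_var τ t x hx u hu with ⟨i, b, p, rfl, hb, e⟩ | ⟨i, p, rfl, h1, e⟩ |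
        ⟨j, w, rfl, e⟩ <;>
      rcases vis_var τ t x hx v hv with ⟨i', b', p', rfl, hb', e'⟩ | ⟨i', p', rfl, h1', e'⟩ |
        ⟨j', w', rfl, e'⟩ <;> simp only [PhiRel] at h <;> rw [e, e']
    · obtain ⟨rfl, h⟩ := h
      exfalso
      revert h hb hb'; cases b <;> cases b' <;> cases τ i <;> simp
    · exact Or.inr (Or.inr ⟨false, _, by decide, Or.inr ⟨rfl, by omega⟩, rfl⟩)
    · exact Or.inl (Or.inr ⟨false, _, by decide, Or.inr ⟨rfl, by omega⟩, rfl⟩)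
    · obtain ⟨rfl, h⟩ := h
      exact (h rfl).elim
    · exfalso
      obtain ⟨rfl, rfl⟩ := h
      exact hb' ((ht _ _).2 rfl).symm
    · exact Or.inr (Or.inr ⟨true, _, by decide, Or.inl ⟨rfl, by omega⟩, rfl⟩)

/-- If the 3-CNF formula `φ` has a truth assignment `τ` under
which every clause contains exactly one true literal, then `G(φ)` admits a
planar geometric storyplan. (The literal `φ j k = (i, b)` is true under `τ`
iff `τ i = b`.) -/
theorem one_in_three_sat_implies_geom_storyplan
    (n m : ℕ) (φ : Fin m → Fin 3 → Fin n × Bool)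
    (hsat : ∃ τ : Fin n → Bool, ∀ j : Fin m, ∃! k : Fin 3, τ (φ j k).1 = (φ j k).2) :
    HasGeomStoryplan (PhiGraph φ) := by
  obtain ⟨τ, hτ⟩ := hsat
  choose t ht ht' using hτ
  have htt : ∀ j k, τ (φ j k).1 = (φ j k).2 ↔ k = t j := by
    intro j k
    constructor
    · exact ht' j k
    · rintro rfl; exact ht j
  refine ⟨3 * n + 9 * m + 1, sT τ t, eT τ t, fun v => toR (lab τ t v), by omega, times_ok τ t,
    adj_sym φ (fun u v => ∃ x, sT τ t u ≤ x ∧ x ≤ eT τ t u ∧ sT τ t v ≤ x ∧ x ≤ eT τ t v)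
      (fun u v ⟨x, h1, h2, h3, h4⟩ => ⟨x, h3, h4, h1, h2⟩) (overlap φ τ t htt), ?_⟩
  intro x hx1 hx2
  by_cases hx : x ≤ 3 * n ∨ x = 3 * n + 9 * m + 1
  · exact frame_var φ τ t htt x hx
  · push Not at hx
    have := frame_clause φ τ t htt ⟨(x - 3 * n - 1) / 9, by omega⟩
      ⟨(x - 3 * n - 1) % 9 + 1, by omega⟩ (by simp)
    have e : x = 3 * n + 9 * ((x - 3 * n - 1) / 9) + ((x - 3 * n - 1) % 9 + 1) := by omega
    simp only [← e] at this
    exact this
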